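/- arXiv:1802.04026 — 2 statements merged into one kernel-verified Lean document; each statement's English description precedes it below -/
import Mathlib

section
/- Let a be a polynomial with all zeros on the unit circle. The multipliers from H^2 to M(\bar{a}) are 𝔐(1, \bar{a}) = a·H^∞. -/
open Complex Set

noncomputable section

/-- The open unit disk in `ℂ`. -/
def unitDisk : Set ℂ := Metric.ball 0 1

/-- The `n`-th Taylor coefficient of `f` at `0`. -/
def coef (f : ℂ → ℂ) (n : ℕ) : ℂ := iteratedDeriv n f 0 / (n.factorial : ℂ)

/-- `f` belongs to the Hardy space `H²` of the unit disk. -/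
def MemH2 (f : ℂ → ℂ) : Prop :=
  DifferentiableOn ℂ f unitDisk ∧ Summable fun n => ‖coef f n‖ ^ 2

/-- The `H²` norm. -/
def norm2 (f : ℂ → ℂ) : ℝ := Real.sqrt (∑' n, ‖coef f n‖ ^ 2)

/-- The `H²` inner product. -/
def inner2 (f g : ℂ → ℂ) : ℂ := ∑' n, coef f n * (starRingEnd ℂ) (coef g n)

/-- `f` belongs to `H^∞`: bounded and analytic on the unit disk. -/
def MemHinf (f : ℂ → ℂ) : Prop :=
  DifferentiableOn ℂ f unitDisk ∧ ∃ C, ∀ z ∈ unitDisk, ‖f z‖ ≤ C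

/-- The `H^∞` (sup) norm. -/
def normInf (f : ℂ → ℂ) : ℝ := sSup ((fun z => ‖f z‖) '' unitDisk)

/-- The co-analytic Toeplitz operator `T_{\bar a}` in terms of Taylor
coefficients: the `n`-th coefficient of `T_{\bar a} f` is
`∑ₖ conj (â k) * f̂ (n + k)`. -/
def Tbar (a f : ℂ → ℂ) : ℂ → ℂ :=
  fun z => ∑' n : ℕ, (∑' k : ℕ, (starRingEnd ℂ) (coef a k) * coef f (n + k)) * z ^ n

/-- Membership in the range space `M(ā) = T_{\bar a} H²` (as functions on the disk). -/
def MemMbar (a g : ℂ → ℂ) : Prop :=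
  ∃ f, MemH2 f ∧ Set.EqOn g (Tbar a f) unitDisk

/-- The range norm on `M(ā)`: `‖T_{\bar a} f‖_{ā} = ‖f‖_{H²}`. -/
def normMbar (a g : ℂ → ℂ) : ℝ :=
  sInf {r | ∃ f, MemH2 f ∧ Set.EqOn g (Tbar a f) unitDisk ∧ r = norm2 f}

/-- `a` is outer: the analytic Toeplitz operator `T_a` (multiplication by `a`)
has dense range in `H²`. -/
def Outer (a : ℂ → ℂ) : Prop :=
  ∀ g, MemH2 g → ∀ ε > 0, ∃ f, MemH2 f ∧ norm2 (fun z => g z - a z * f z) < ε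

/-- `u` is inner: multiplication by `u` is isometric on `H²`. -/
def IsInner (u : ℂ → ℂ) : Prop :=
  MemHinf u ∧ ∀ f, MemH2 f → norm2 (fun z => u z * f z) = norm2 f

/-- `p` is (given by) a polynomial of degree `< N`, i.e. of degree at most `N - 1`. -/
def MemPoly (N : ℕ) (p : ℂ → ℂ) : Prop :=
  ∃ q : Polynomial ℂ, q.degree < (N : WithBot ℕ) ∧ ∀ z, p z = q.eval z

/-- `φ` is a multiplier from `M(ā₁)` to `M(ā₂)`. -/
def Mult (a₁ a₂ φ : ℂ → ℂ) : Prop :=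
  DifferentiableOn ℂ φ unitDisk ∧
    ∀ f, MemMbar a₁ f → MemMbar a₂ fun z => φ z * f z

/-- The backward shift `B f = (f - f 0) / z`. -/
def Bshift (f : ℂ → ℂ) : ℂ → ℂ :=
  fun z => if z = 0 then deriv f 0 else (f z - f 0) / z


/-- The square-summable sequences. -/
def SqSummable (u : ℕ → ℂ) : Prop := Summable fun n => ‖u n‖ ^ 2

/-- The sequences whose power series converges absolutely on the unit disk. -/
def DiskSummable (u : ℕ → ℂ) : Prop := ∀ z ∈ unitDisk, Summable fun n => ‖u n * z ^ n‖

/-- The function on the unit disk with Taylor coefficients `u`. -/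
def pseries (u : ℕ → ℂ) (z : ℂ) : ℂ := ∑' n, u n * z ^ n

lemma mem_unitDisk {z : ℂ} : z ∈ unitDisk ↔ ‖z‖ < 1 := by simp [unitDisk]

lemma isOpen_unitDisk : IsOpen unitDisk := Metric.isOpen_ball

lemma zero_mem_unitDisk : (0 : ℂ) ∈ unitDisk := by simp [unitDisk]

lemma unitDisk_mem_nhds_zero : unitDisk ∈ nhds (0 : ℂ) :=
  isOpen_unitDisk.mem_nhds zero_mem_unitDisk

lemma hasSum_sq_norm_pow {z : ℂ} (hz : z ∈ unitDisk) :
    HasSum (fun n => (‖z‖ ^ n) ^ 2) (1 - ‖z‖ ^ 2)⁻¹ := by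
  have h := hasSum_geometric_of_lt_one (r := ‖z‖ ^ 2) (by positivity)
    (by have := mem_unitDisk.1 hz; nlinarith [norm_nonneg z])
  simpa only [← pow_mul, mul_comm] using h

lemma SqSummable.diskSummable {u : ℕ → ℂ} (hu : SqSummable u) : DiskSummable u := by
  intro z hz
  refine Summable.of_nonneg_of_le (fun _ => norm_nonneg _) (fun n => ?_)
    (hu.add (hasSum_sq_norm_pow hz).summable)
  rw [norm_mul, norm_pow]
  nlinarith [sq_nonneg (‖u n‖ - ‖z‖ ^ n), norm_nonneg (u n), pow_nonneg (norm_nonneg z) n]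

lemma DiskSummable.hasSum {u : ℕ → ℂ} (hu : DiskSummable u) {z : ℂ} (hz : z ∈ unitDisk) :
    HasSum (fun n => u n * z ^ n) (pseries u z) :=
  (hu z hz).of_norm.hasSum

lemma eball_eq_unitDisk : Metric.eball (0 : ℂ) 1 = unitDisk := by
  simpa [unitDisk] using Metric.eball_ofReal (x := (0 : ℂ)) (ε := 1)

lemma DiskSummable.hasFPowerSeriesOnBall {u : ℕ → ℂ} (hu : DiskSummable u) :
    HasFPowerSeriesOnBall (pseries u) (FormalMultilinearSeries.ofScalars ℂ u) 0 1 where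
  r_le := by
    refine ENNReal.le_of_forall_nnreal_lt fun r hr => ?_
    refine FormalMultilinearSeries.le_radius_of_summable_norm _ ?_
    have hr' : (r : ℝ) < 1 := by exact_mod_cast hr
    have := hu (r : ℝ) (mem_unitDisk.2 (by simpa using hr'))
    refine this.congr fun n => ?_
    simp
  r_pos := one_pos
  hasSum := by
    intro y hy
    simpa [FormalMultilinearSeries.ofScalars_apply_eq, mul_comm] using
      hu.hasSum (eball_eq_unitDisk ▸ hy)

lemma DiskSummable.differentiableOn {u : ℕ → ℂ} (hu : DiskSummable u) :
    DifferentiableOn ℂ (pseries u) unitDisk := by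
  have h := hu.hasFPowerSeriesOnBall.differentiableOn
  rwa [eball_eq_unitDisk] at h

lemma DiskSummable.coef_eq {u : ℕ → ℂ} (hu : DiskSummable u) {f : ℂ → ℂ}
    (hf : EqOn f (pseries u) unitDisk) : coef f = u := by
  have h1 : HasFPowerSeriesAt f (FormalMultilinearSeries.ofScalars ℂ u) 0 :=
    hu.hasFPowerSeriesOnBall.hasFPowerSeriesAt.congr
      (Filter.eventually_of_mem unitDisk_mem_nhds_zero fun z hz => (hf hz).symm)
  have h2 := h1.analyticAt.hasFPowerSeriesAt
  exact FormalMultilinearSeries.ofScalars_series_injective ℂ ℂ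
    (h2.eq_formalMultilinearSeries h1)

lemma hasSum_coef {f : ℂ → ℂ} (hf : DifferentiableOn ℂ f unitDisk) {z : ℂ} (hz : z ∈ unitDisk) :
    HasSum (fun n => coef f n * z ^ n) (f z) := by
  have h := Complex.hasSum_taylorSeries_on_ball hf hz
  simp only [sub_zero, smul_eq_mul] at h
  refine h.congr_fun (fun n => ?_)
  rw [coef]; ring

lemma eqOn_pseries_coef {f : ℂ → ℂ} (hf : DifferentiableOn ℂ f unitDisk) :
    EqOn f (pseries (coef f)) unitDisk := fun _ hz => (hasSum_coef hf hz).tsum_eq.symm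

lemma diskSummable_coef {f : ℂ → ℂ} (hf : DifferentiableOn ℂ f unitDisk) :
    DiskSummable (coef f) := fun _ hz => (hasSum_coef hf hz).summable.norm

lemma DiskSummable.ext {u v : ℕ → ℂ} (hu : DiskSummable u) (hv : DiskSummable v)
    (h : EqOn (pseries u) (pseries v) unitDisk) : u = v := by
  rw [← hu.coef_eq (fun _ _ => rfl), hv.coef_eq h]

lemma SqSummable.memH2 {u : ℕ → ℂ} (hu : SqSummable u) : MemH2 (pseries u) := by
  refine ⟨hu.diskSummable.differentiableOn, ?_⟩
  rw [hu.diskSummable.coef_eq fun _ _ => rfl]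
  exact hu

lemma norm_pseries_le {u : ℕ → ℂ} (hu : SqSummable u) {z : ℂ} (hz : z ∈ unitDisk) :
    ‖pseries u z‖ ≤ √(∑' n, ‖u n‖ ^ 2) * √(1 - ‖z‖ ^ 2)⁻¹ := by
  refine (norm_tsum_le_tsum_norm (hu.diskSummable z hz)).trans ?_
  refine Summable.tsum_le_of_sum_le (hu.diskSummable z hz) fun s => ?_
  simp only [norm_mul, norm_pow]
  refine (Real.sum_mul_le_sqrt_mul_sqrt s _ _).trans ?_
  have h := hasSum_sq_norm_pow hz
  gcongr
  · exact hu.sum_le_tsum s fun _ _ => by positivity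
  · exact sum_le_hasSum s (fun _ _ => by positivity) h

lemma pseries_add {u v : ℕ → ℂ} (hu : DiskSummable u) (hv : DiskSummable v) {z : ℂ}
    (hz : z ∈ unitDisk) : pseries (u + v) z = pseries u z + pseries v z := by
  refine HasSum.tsum_eq ?_
  simpa [add_mul] using (hu.hasSum hz).add (hv.hasSum hz)

lemma pseries_smul (c : ℂ) (u : ℕ → ℂ) (z : ℂ) : pseries (c • u) z = c * pseries u z := by
  simp [pseries, mul_assoc, tsum_mul_left]

lemma pseries_sub {u v : ℕ → ℂ} (hu : DiskSummable u) (hv : DiskSummable v) {z : ℂ}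
    (hz : z ∈ unitDisk) : pseries (u - v) z = pseries u z - pseries v z := by
  refine HasSum.tsum_eq ?_
  simpa [sub_mul] using (hu.hasSum hz).sub (hv.hasSum hz)

lemma SqSummable.add {u v : ℕ → ℂ} (hu : SqSummable u) (hv : SqSummable v) :
    SqSummable (u + v) := by
  refine Summable.of_nonneg_of_le (fun _ => by positivity) (fun n => ?_)
    ((hu.mul_left 2).add (hv.mul_left 2))
  have := norm_add_le (u n) (v n)
  simp only [Pi.add_apply]
  nlinarith [sq_nonneg (‖u n‖ - ‖v n‖), norm_nonneg (u n + v n)]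

lemma SqSummable.smul {u : ℕ → ℂ} (hu : SqSummable u) (c : ℂ) : SqSummable (c • u) := by
  simpa [SqSummable, mul_pow] using Summable.mul_left (‖c‖ ^ 2) hu

lemma SqSummable.sub {u v : ℕ → ℂ} (hu : SqSummable u) (hv : SqSummable v) :
    SqSummable (u - v) := by
  simpa [sub_eq_add_neg] using hu.add (hv.smul (-1))

/-- The backward shift on sequences. -/
def seqL : Module.End ℂ (ℕ → ℂ) := LinearMap.funLeft ℂ ℂ (· + 1)

/-- The forward shift on sequences. -/
def seqR : Module.End ℂ (ℕ → ℂ) where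
  toFun u n := n.casesOn 0 u
  map_add' u v := by ext n; cases n <;> simp
  map_smul' c u := by ext n; cases n <;> simp

@[simp] lemma seqL_apply (u : ℕ → ℂ) (n : ℕ) : seqL u n = u (n + 1) := rfl

@[simp] lemma seqR_zero (u : ℕ → ℂ) : seqR u 0 = 0 := rfl

@[simp] lemma seqR_succ (u : ℕ → ℂ) (n : ℕ) : seqR u (n + 1) = u n := rfl

lemma seqL_mul_seqR : seqL * seqR = 1 := by ext; simp

lemma seqL_pow_apply (u : ℕ → ℂ) (k n : ℕ) : (seqL ^ k) u n = u (n + k) := by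
  induction k generalizing n with
  | zero => simp
  | succ k ih => rw [pow_succ', Module.End.mul_apply, seqL_apply, ih]; congr 1; ring

lemma SqSummable.seqL {u : ℕ → ℂ} (hu : SqSummable u) : SqSummable (seqL u) :=
  (summable_nat_add_iff (f := fun n => ‖u n‖ ^ 2) 1).2 hu

lemma SqSummable.seqR {u : ℕ → ℂ} (hu : SqSummable u) : SqSummable (seqR u) :=
  (summable_nat_add_iff (f := fun n => ‖_root_.seqR u n‖ ^ 2) 1).1 hu

lemma mul_pseries_seqL {u : ℕ → ℂ} (hu : DiskSummable u) {z : ℂ} (hz : z ∈ unitDisk) :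
    z * pseries (seqL u) z = pseries u z - u 0 := by
  have h := (hasSum_nat_add_iff' 1).2 (hu.hasSum hz)
  simp only [Finset.sum_range_one, pow_zero, mul_one] at h
  rw [← h.tsum_eq, pseries, ← tsum_mul_left]
  exact tsum_congr fun n => by simp; ring

lemma pseries_seqR {u : ℕ → ℂ} (hu : DiskSummable u) {z : ℂ} (hz : z ∈ unitDisk) :
    pseries (seqR u) z = z * pseries u z := by
  refine HasSum.tsum_eq ((hasSum_nat_add_iff' 1).1 ?_)
  simp only [Finset.sum_range_one, seqR_zero, zero_mul, sub_zero, seqR_succ]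
  exact ((hu.hasSum hz).mul_left z).congr_fun fun n => by ring

lemma sqSummable_lp (x : lp (fun _ : ℕ => ℂ) 2) : SqSummable x := by
  simpa [SqSummable] using (memℓp_gen_iff (p := 2) (by norm_num)).1 (lp.memℓp x)

lemma SqSummable.memℓp {u : ℕ → ℂ} (hu : SqSummable u) : Memℓp u 2 := by
  refine (memℓp_gen_iff (by norm_num)).2 ?_
  simpa [SqSummable] using hu

lemma norm_pseries_lp_le (x : lp (fun _ : ℕ => ℂ) 2) {z : ℂ} (hz : z ∈ unitDisk) :
    ‖pseries x z‖ ≤ √(1 - ‖z‖ ^ 2)⁻¹ * ‖x‖ := by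
  have h := norm_pseries_le (sqSummable_lp x) hz
  have e : ‖x‖ = √(∑' n, ‖x n‖ ^ 2) := by
    rw [lp.norm_eq_tsum_rpow (by norm_num)]
    simp [Real.sqrt_eq_rpow]
  rwa [e, mul_comm]

/-- Point evaluation on `ℓ²`, seen as `H²`. -/
def evalLp (z : ℂ) (hz : z ∈ unitDisk) : lp (fun _ : ℕ => ℂ) 2 →L[ℂ] ℂ :=
  LinearMap.mkContinuous
    { toFun := fun x => pseries x z
      map_add' := fun x y => pseries_add (sqSummable_lp x).diskSummable
        (sqSummable_lp y).diskSummable hz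
      map_smul' := fun c x => pseries_smul c x z }
    (√(1 - ‖z‖ ^ 2)⁻¹) fun x => norm_pseries_lp_le x hz

@[simp] lemma evalLp_apply (z : ℂ) (hz : z ∈ unitDisk) (x : lp (fun _ : ℕ => ℂ) 2) :
    evalLp z hz x = pseries x z := rfl

lemma evalLp_ne_zero (z : ℂ) (hz : z ∈ unitDisk) : evalLp z hz ≠ 0 := by
  intro h
  have h1 : evalLp z hz (lp.single 2 0 1) = 0 := by rw [h]; rfl
  rw [evalLp_apply, pseries, tsum_eq_single 0] at h1
  · simp at h1
  · intro n hn
    simp [hn]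

lemma lp_ext_pseries {x y : lp (fun _ : ℕ => ℂ) 2}
    (h : EqOn (pseries x) (pseries y) unitDisk) : x = y :=
  lp.ext ((sqSummable_lp x).diskSummable.ext (sqSummable_lp y).diskSummable h)

/-- A multiplier of `H²` is bounded. -/
lemma memHinf_of_multiplier {φ : ℂ → ℂ} (hφ : DifferentiableOn ℂ φ unitDisk)
    (h : ∀ u, SqSummable u → ∃ v, SqSummable v ∧
      ∀ z ∈ unitDisk, φ z * pseries u z = pseries v z) : MemHinf φ := by
  choose! m hm hmz using h
  let T₀ : lp (fun _ : ℕ => ℂ) 2 → lp (fun _ : ℕ => ℂ) 2 :=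
    fun x => ⟨m x, (hm x (sqSummable_lp x)).memℓp⟩
  have hT₀ : ∀ x z, z ∈ unitDisk → pseries (T₀ x) z = φ z * pseries x z :=
    fun x z hz => (hmz x (sqSummable_lp x) z hz).symm
  let T : lp (fun _ : ℕ => ℂ) 2 →ₗ[ℂ] lp (fun _ : ℕ => ℂ) 2 :=
    { toFun := T₀
      map_add' := fun x y => lp_ext_pseries fun z hz => by
        have hE : ∀ w : lp (fun _ : ℕ => ℂ) 2, pseries w z = evalLp z hz w := fun _ => rfl
        rw [hT₀ _ z hz, hE, hE, map_add, map_add, ← hE, ← hE, ← hE, ← hE, hT₀ _ z hz,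
          hT₀ _ z hz, mul_add]
      map_smul' := fun c x => lp_ext_pseries fun z hz => by
        have hE : ∀ w : lp (fun _ : ℕ => ℂ) 2, pseries w z = evalLp z hz w := fun _ => rfl
        rw [hT₀ _ z hz, hE, hE, map_smul, RingHom.id_apply, map_smul, ← hE, ← hE, hT₀ _ z hz]
        simp only [smul_eq_mul]
        ring }
  have hT : Continuous T := T.continuous_of_seq_closed_graph fun s x y hs hTs =>
    lp_ext_pseries fun z hz => by
      have h1 := ((evalLp z hz).continuous.tendsto y).comp hTs
      have h2 := (((evalLp z hz).continuous.tendsto x).comp hs).const_mul (φ z)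
      refine (tendsto_nhds_unique h1 (h2.congr fun n => ?_)).trans (hT₀ x z hz).symm
      exact (hT₀ (s n) z hz).symm
  let S : lp (fun _ : ℕ => ℂ) 2 →L[ℂ] lp (fun _ : ℕ => ℂ) 2 := ⟨T, hT⟩
  refine ⟨hφ, ‖S‖, fun z hz => ?_⟩
  have h1 : (evalLp z hz).comp S = φ z • evalLp z hz :=
    ContinuousLinearMap.ext fun x => hT₀ x z hz
  have h2 := (evalLp z hz).opNorm_comp_le S
  rw [h1, norm_smul, mul_comm] at h2
  exact le_of_mul_le_mul_left h2 (norm_pos_iff.2 (evalLp_ne_zero z hz))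

lemma fourier_natCast_eq_pow (n : ℕ) (t : UnitAddCircle) :
    fourier (n : ℤ) t = (fourier 1 t) ^ n := by
  induction n with
  | zero => simp
  | succ n ih => rw [Nat.cast_succ, fourier_add, ih, pow_succ]

/-- Parseval's identity on the circle of radius `r < 1`. -/
lemma exists_lp_circle {u : ℕ → ℂ} (hu : DiskSummable u) {r : ℝ} (hr0 : 0 ≤ r) (hr : r < 1) :
    ∃ F : MeasureTheory.Lp ℂ 2 (AddCircle.haarAddCircle (T := 1)),
      (∀ᵐ t ∂AddCircle.haarAddCircle, F t = pseries u (r * fourier 1 t)) ∧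
      HasSum (fun n => ‖u n * (r : ℂ) ^ n‖ ^ 2) (‖F‖ ^ 2) := by
  have hrD : (r : ℂ) ∈ unitDisk := by
    rw [mem_unitDisk, Complex.norm_of_nonneg hr0]; exact hr
  let c : ℕ → C(UnitAddCircle, ℂ) := fun n => (u n * (r : ℂ) ^ n) • fourier (n : ℤ)
  have hc : Summable c := by
    refine Summable.of_norm ((hu _ hrD).congr fun n => ?_)
    rw [norm_smul, fourier_norm, mul_one]
  let L := ContinuousMap.toLp (E := ℂ) 2 (AddCircle.haarAddCircle (T := (1 : ℝ))) ℂ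
  refine ⟨L (∑' n, c n), ?_, ?_⟩
  · filter_upwards [ContinuousMap.coeFn_toLp (p := 2) (𝕜 := ℂ)
      (AddCircle.haarAddCircle (T := (1 : ℝ))) (∑' n, c n)] with t ht
    have h1 : HasSum (fun n => c n t) ((∑' n, c n) t) :=
      ContinuousMap.hasSum_apply hc.hasSum t
    rw [ht, ← h1.tsum_eq]
    refine tsum_congr fun n => ?_
    simp only [c, ContinuousMap.smul_apply, fourier_natCast_eq_pow, smul_eq_mul]
    ring
  · have h := (hc.hasSum.mapL L)
    have h2 : Filter.Tendsto (fun s : Finset ℕ => ‖∑ n ∈ s, L (c n)‖ ^ 2) Filter.atTop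
      (nhds (‖L (∑' n, c n)‖ ^ 2)) := (h.norm).pow 2
    refine h2.congr fun s => ?_
    have ho : Orthonormal ℂ fun n : ℕ => fourierLp (T := (1 : ℝ)) 2 (n : ℤ) :=
      orthonormal_fourier.comp _ Nat.cast_injective
    have e : ∀ n, L (c n) = (u n * (r : ℂ) ^ n) • fourierLp (T := (1 : ℝ)) 2 (n : ℤ) :=
      fun n => map_smul L _ _
    have h3 := inner_self_eq_norm_sq (𝕜 := ℂ) (∑ n ∈ s, L (c n))
    simp only [e, ho.inner_sum] at h3
    simp only [e, ← h3, map_sum, RCLike.conj_mul]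
    refine Finset.sum_congr rfl fun n _ => ?_
    norm_cast

/-- A bounded analytic function maps `H²` to itself. -/
lemma MemHinf.sqSummable_coef_mul {ψ : ℂ → ℂ} (hψ : MemHinf ψ) {u : ℕ → ℂ} (hu : SqSummable u) :
    SqSummable (coef fun z => ψ z * pseries u z) := by
  obtain ⟨hd, C, hC⟩ := hψ
  have hC0 : 0 ≤ C := (norm_nonneg _).trans (hC 0 zero_mem_unitDisk)
  set g := fun z => ψ z * pseries u z with hg
  have hgd : DifferentiableOn ℂ g unitDisk := hd.mul hu.diskSummable.differentiableOn
  refine summable_of_sum_range_le (c := C ^ 2 * ∑' n, ‖u n‖ ^ 2) (fun _ => by positivity)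
    fun N => ?_
  have key : ∀ r : ℝ, 0 ≤ r → r < 1 →
      ∑ n ∈ Finset.range N, ‖coef g n * (r : ℂ) ^ n‖ ^ 2 ≤ C ^ 2 * ∑' n, ‖u n‖ ^ 2 := by
    intro r hr0 hr
    obtain ⟨F, hF, hFs⟩ := exists_lp_circle hu.diskSummable hr0 hr
    obtain ⟨G, hG, hGs⟩ := exists_lp_circle (diskSummable_coef hgd) hr0 hr
    have hD : ∀ t : UnitAddCircle, (r : ℂ) * fourier 1 t ∈ unitDisk := fun t => by
      rw [mem_unitDisk, norm_mul, Complex.norm_of_nonneg hr0]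
      simpa [Circle.norm_coe] using hr
    have hGF : ‖G‖ ≤ C * ‖F‖ := by
      refine MeasureTheory.Lp.norm_le_mul_norm_of_ae_le_mul ?_
      filter_upwards [hF, hG] with t h1 h2
      rw [h1, h2, ← eqOn_pseries_coef hgd (hD t), hg, norm_mul]
      gcongr
      exact hC _ (hD t)
    have hFu : ‖F‖ ^ 2 ≤ ∑' n, ‖u n‖ ^ 2 := by
      refine hasSum_le (fun n => ?_) hFs hu.hasSum
      rw [norm_mul, norm_pow, Complex.norm_of_nonneg hr0]
      gcongr
      exact mul_le_of_le_one_right (norm_nonneg _) (pow_le_one₀ hr0 hr.le)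
    calc _ ≤ ‖G‖ ^ 2 := sum_le_hasSum _ (fun _ _ => by positivity) hGs
      _ ≤ (C * ‖F‖) ^ 2 := by gcongr
      _ = C ^ 2 * ‖F‖ ^ 2 := by ring
      _ ≤ _ := by gcongr
  have hlim : Filter.Tendsto (fun r : ℝ => ∑ n ∈ Finset.range N, ‖coef g n * (r : ℂ) ^ n‖ ^ 2)
      (nhdsWithin 1 (Iio 1)) (nhds (∑ n ∈ Finset.range N, ‖coef g n‖ ^ 2)) := by
    have : Continuous fun r : ℝ => ∑ n ∈ Finset.range N, ‖coef g n * (r : ℂ) ^ n‖ ^ 2 := by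
      fun_prop
    simpa using (this.tendsto 1).mono_left nhdsWithin_le_nhds
  refine le_of_tendsto hlim ?_
  filter_upwards [self_mem_nhdsWithin, mem_nhdsWithin_of_mem_nhds (Ioi_mem_nhds one_pos)]
    with r h1 h0
  exact key r (le_of_lt h0) h1

open Filter Topology ComplexConjugate

lemma radial_mem_unitDisk {ζ : ℂ} (hζ : ‖ζ‖ = 1) {r : ℝ} (hr0 : 0 < r) (hr : r < 1) :
    (r : ℂ) * ζ ∈ unitDisk := by
  rw [mem_unitDisk, norm_mul, hζ, mul_one, Complex.norm_of_nonneg hr0.le]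
  exact hr

lemma eventually_radial : ∀ᶠ r : ℝ in 𝓝[<] 1, 0 < r ∧ r < 1 := by
  filter_upwards [self_mem_nhdsWithin, mem_nhdsWithin_of_mem_nhds (Ioi_mem_nhds one_pos)]
    with r h1 h0
  exact ⟨h0, h1⟩

/-- Functions in `H²` are `o((1 - r) ^ (-1 / 2))` along radii. -/
lemma tendsto_sqrt_mul_norm_pseries {u : ℕ → ℂ} (hu : SqSummable u) {ζ : ℂ} (hζ : ‖ζ‖ = 1) :
    Tendsto (fun r : ℝ => √(1 - r) * ‖pseries u (r * ζ)‖) (𝓝[<] 1) (𝓝 0) := by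
  rw [Metric.tendsto_nhds]
  intro ε hε
  have ht := tendsto_sum_nat_add fun n => ‖u n‖ ^ 2
  obtain ⟨N, hN⟩ := (ht.eventually_lt_const (show (0 : ℝ) < (ε / 2) ^ 2 by positivity)).exists
  have hu' : SqSummable fun k => u (k + N) :=
    (summable_nat_add_iff (f := fun n => ‖u n‖ ^ 2) N).2 hu
  have htail : √(∑' k, ‖u (k + N)‖ ^ 2) < ε / 2 := by
    rw [Real.sqrt_lt' (by positivity)]
    exact hN
  have hpoly : Tendsto (fun r : ℝ => √(1 - r) * ‖∑ n ∈ Finset.range N, u n * (r * ζ : ℂ) ^ n‖)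
      (𝓝[<] 1) (𝓝 0) := by
    have hc : Continuous
        fun r : ℝ => √(1 - r) * ‖∑ n ∈ Finset.range N, u n * (r * ζ : ℂ) ^ n‖ := by fun_prop
    simpa using (hc.tendsto 1).mono_left nhdsWithin_le_nhds
  filter_upwards [eventually_radial, hpoly.eventually_lt_const (half_pos hε)] with r ⟨h0, h1⟩ hp
  have hz := radial_mem_unitDisk hζ h0 h1
  set z : ℂ := r * ζ with hzdef
  have hzn : ‖z‖ = r := by rw [hzdef, norm_mul, hζ, mul_one, Complex.norm_of_nonneg h0.le]
  have hsplit : pseries u z = ∑ n ∈ Finset.range N, u n * z ^ n +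
      z ^ N * pseries (fun k => u (k + N)) z := by
    rw [pseries, ← (hu.diskSummable z hz).of_norm.sum_add_tsum_nat_add N, pseries,
      ← tsum_mul_left]
    congr 1
    exact tsum_congr fun n => by ring
  have hsq : √(1 - r) * √(1 - r ^ 2)⁻¹ ≤ 1 := by
    rw [← Real.sqrt_mul (by linarith), ← div_eq_mul_inv]
    refine Real.sqrt_le_one.2 ((div_le_one (by nlinarith)).2 ?_)
    nlinarith
  have h2 : ‖z ^ N * pseries (fun k => u (k + N)) z‖ ≤
      √(∑' k, ‖u (k + N)‖ ^ 2) * √(1 - r ^ 2)⁻¹ := by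
    rw [norm_mul, norm_pow, hzn, ← hzn]
    refine (mul_le_of_le_one_left (norm_nonneg _) (pow_le_one₀ (norm_nonneg _) ?_)).trans
      (norm_pseries_le hu' hz)
    rw [hzn]; exact h1.le
  rw [Real.dist_eq, sub_zero, abs_of_nonneg (by positivity)]
  calc √(1 - r) * ‖pseries u z‖
      ≤ √(1 - r) * (‖∑ n ∈ Finset.range N, u n * z ^ n‖ +
          √(∑' k, ‖u (k + N)‖ ^ 2) * √(1 - r ^ 2)⁻¹) := by
        rw [hsplit]
        gcongr
        exact (norm_add_le _ _).trans (by gcongr)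
    _ = √(1 - r) * ‖∑ n ∈ Finset.range N, u n * z ^ n‖ +
          √(∑' k, ‖u (k + N)‖ ^ 2) * (√(1 - r) * √(1 - r ^ 2)⁻¹) := by ring
    _ ≤ √(1 - r) * ‖∑ n ∈ Finset.range N, u n * z ^ n‖ + √(∑' k, ‖u (k + N)‖ ^ 2) * 1 := by
        gcongr
    _ < ε := by linarith

lemma sqSummable_single : SqSummable (Pi.single 0 1) :=
  summable_of_ne_finset_zero (s := {0}) fun n hn => by
    simp [Finset.notMem_singleton.1 hn]

lemma pseries_single (z : ℂ) : pseries (Pi.single 0 1) z = 1 := by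
  rw [pseries, tsum_eq_single 0]
  · simp
  · intro n hn
    simp [hn]

lemma tendsto_mul_pseries_mul {u v : ℕ → ℂ} (hu : SqSummable u) (hv : SqSummable v) {ζ : ℂ}
    (hζ : ‖ζ‖ = 1) :
    Tendsto (fun r : ℝ => (1 - r : ℂ) * (pseries u (r * ζ) * pseries v (r * ζ)))
      (𝓝[<] 1) (𝓝 0) := by
  rw [tendsto_zero_iff_norm_tendsto_zero]
  have h := (tendsto_sqrt_mul_norm_pseries hu hζ).mul (tendsto_sqrt_mul_norm_pseries hv hζ)
  rw [mul_zero] at h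
  refine h.congr' ?_
  filter_upwards [eventually_radial] with r ⟨h0, h1⟩
  have e : ‖(1 - r : ℂ)‖ = √(1 - r) * √(1 - r) := by
    rw [Real.mul_self_sqrt (by linarith), ← Complex.ofReal_one, ← Complex.ofReal_sub,
      Complex.norm_of_nonneg (by linarith)]
  rw [norm_mul, norm_mul, e]
  ring

/-- There is a function in `H²` without radial limit at `ζ`. -/
lemma exists_not_tendsto_radial {ζ : ℂ} (hζ : ‖ζ‖ = 1) :
    ∃ u, SqSummable u ∧ ∀ l, ¬ Tendsto (fun r : ℝ => pseries u (r * ζ)) (𝓝[<] 1) (𝓝 l) := by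
  have hζ' : conj ζ * ζ = 1 := by rw [RCLike.conj_mul, hζ]; simp
  let u : ℕ → ℂ := fun n => conj ζ ^ n * (1 / ((n : ℝ) + 1) : ℝ)
  have hu : SqSummable u := by
    have h := (summable_nat_add_iff 1).2 (Real.summable_one_div_nat_pow.2 one_lt_two)
    refine h.congr fun n => ?_
    simp only [u, norm_mul, norm_pow, RCLike.norm_conj, hζ, one_pow, one_mul]
    rw [Complex.norm_of_nonneg (by positivity)]
    push_cast
    rw [div_pow, one_pow]
  refine ⟨u, hu, fun l hl => ?_⟩
  have hterm : ∀ (r : ℝ) (n : ℕ), u n * (r * ζ : ℂ) ^ n = (1 / ((n : ℝ) + 1) * r ^ n : ℝ) := by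
    intro r n
    have : conj ζ ^ n * ζ ^ n = 1 := by rw [← mul_pow, hζ', one_pow]
    simp only [u]
    push_cast
    rw [mul_pow]
    linear_combination (1 / ((n : ℂ) + 1) * (r : ℂ) ^ n) * this
  have hle : ∀ N, ∑ n ∈ Finset.range N, 1 / ((n : ℝ) + 1) ≤ ‖l‖ := by
    intro N
    have hc : Continuous fun r : ℝ => ∑ n ∈ Finset.range N, 1 / ((n : ℝ) + 1) * r ^ n := by
      fun_prop
    have h1 := (hc.tendsto 1).mono_left (nhdsWithin_le_nhds (s := Iio 1))
    simp only [one_pow, mul_one] at h1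
    refine le_of_tendsto_of_tendsto h1 hl.norm ?_
    filter_upwards [eventually_radial] with r ⟨h0, hr⟩
    have hs := hu.diskSummable.hasSum (radial_mem_unitDisk hζ h0 hr)
    simp only [hterm] at hs
    have hs' := Complex.hasSum_re hs
    simp only [Complex.ofReal_re] at hs'
    exact (sum_le_hasSum _ (fun n _ => by positivity) hs').trans (Complex.re_le_norm _)
  obtain ⟨N, hN⟩ := (Real.tendsto_sum_range_one_div_nat_succ_atTop.eventually_gt_atTop ‖l‖).exists
  exact absurd (hle N) (not_le.2 hN)

/-- A multiplier from `H²` to the range of the co-analytic Toeplitz operator with symbol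
`conj (z - ζ)` is divisible by `z - ζ`, and the multiplication is realised by the quotient. -/
lemma exists_quotient_of_multiplier {φ : ℂ → ℂ} {ζ : ℂ} (hζ : ‖ζ‖ = 1)
    (h : ∀ u, SqSummable u → ∃ w, SqSummable w ∧
      ∀ z ∈ unitDisk, φ z * pseries u z = pseries (seqL w - conj ζ • w) z) :
    ∃ w₁, SqSummable w₁ ∧ (∀ z ∈ unitDisk, z * φ z = (1 - conj ζ * z) * pseries w₁ z) ∧
      ∀ u w, SqSummable u → SqSummable w →
        (∀ z ∈ unitDisk, φ z * pseries u z = pseries (seqL w - conj ζ • w) z) →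
        ∀ z ∈ unitDisk, pseries w z = pseries w₁ z * pseries u z := by
  have hζ' : conj ζ * ζ = 1 := by rw [RCLike.conj_mul, hζ]; simp
  have key : ∀ u w, SqSummable w →
      (∀ z ∈ unitDisk, φ z * pseries u z = pseries (seqL w - conj ζ • w) z) →
      ∀ z ∈ unitDisk, z * φ z * pseries u z = (1 - conj ζ * z) * pseries w z - w 0 := by
    intro u w hw he z hz
    have h1 := he z hz
    rw [pseries_sub hw.seqL.diskSummable (hw.smul _).diskSummable hz, pseries_smul] at h1
    linear_combination z * h1 + mul_pseries_seqL hw.diskSummable hz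
  obtain ⟨w₁, hw₁, he₁⟩ := h _ sqSummable_single
  have key₁ := key _ _ hw₁ he₁
  simp only [pseries_single, mul_one] at key₁
  have hA : ∀ u w, SqSummable w →
      (∀ z ∈ unitDisk, φ z * pseries u z = pseries (seqL w - conj ζ • w) z) →
      ∀ z ∈ unitDisk, w₁ 0 * pseries u z =
        (1 - conj ζ * z) * (pseries u z * pseries w₁ z - pseries w z) + w 0 := by
    intro u w hw he z hz
    linear_combination pseries u z * key₁ z hz - key u w hw he z hz
  have hB : ∀ u w, SqSummable u → SqSummable w →
      (∀ z ∈ unitDisk, φ z * pseries u z = pseries (seqL w - conj ζ • w) z) →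
      Tendsto (fun r : ℝ => w₁ 0 * pseries u (r * ζ)) (𝓝[<] 1) (𝓝 (w 0)) := by
    intro u w hu hw he
    have h1 := ((tendsto_mul_pseries_mul hu hw₁ hζ).sub
      (tendsto_mul_pseries_mul hw sqSummable_single hζ)).add_const (w 0)
    rw [sub_zero, zero_add] at h1
    refine h1.congr' ?_
    filter_upwards [eventually_radial] with r ⟨h0, hr⟩
    rw [hA u w hw he _ (radial_mem_unitDisk hζ h0 hr), pseries_single]
    linear_combination ((r : ℂ) * (pseries u (r * ζ) * pseries w₁ (r * ζ) - pseries w (r * ζ))) *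
      hζ'
  have hc : w₁ 0 = 0 := by
    by_contra hc
    obtain ⟨u, hu, hul⟩ := exists_not_tendsto_radial hζ
    obtain ⟨w, hw, he⟩ := h u hu
    refine hul ((w₁ 0)⁻¹ * w 0) (((hB u w hu hw he).const_mul (w₁ 0)⁻¹).congr fun r => ?_)
    rw [inv_mul_cancel_left₀ hc]
  refine ⟨w₁, hw₁, fun z hz => by rw [key₁ z hz, hc, sub_zero], fun u w hu hw he z hz => ?_⟩
  have hw0 : w 0 = 0 := by
    have h1 := hB u w hu hw he
    simp only [hc, zero_mul] at h1
    exact (tendsto_nhds_unique h1 tendsto_const_nhds)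
  have h1 := hA u w hw he z hz
  rw [hc, hw0, zero_mul, add_zero] at h1
  have hne : 1 - conj ζ * z ≠ 0 := by
    intro h0
    have : ‖conj ζ * z‖ = 1 := by rw [← sub_eq_zero.1 h0, norm_one]
    rw [norm_mul, RCLike.norm_conj, hζ, one_mul] at this
    exact absurd (mem_unitDisk.1 hz) (by rw [this]; exact lt_irrefl 1)
  have h2 := (mul_eq_zero.1 h1.symm).resolve_left hne
  linear_combination -h2

open Polynomial in
lemma sqSummable_aeval_seqL {w : ℕ → ℂ} (hw : SqSummable w) (q : ℂ[X]) :
    SqSummable (aeval seqL q w) := by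
  induction q using Polynomial.induction_on' generalizing w with
  | add p q hp hq => simpa using (hp hw).add (hq hw)
  | monomial n a =>
    have h : ∀ n, SqSummable ((seqL ^ n) w) := fun n => by
      induction n with
      | zero => simpa using hw
      | succ n ih => rw [pow_succ', Module.End.mul_apply]; exact ih.seqL
    rw [aeval_monomial, Module.End.mul_apply, Module.algebraMap_end_apply]
    exact (h n).smul a

lemma SqSummable.seqR_pow {w : ℕ → ℂ} (hw : SqSummable w) (n : ℕ) :
    SqSummable ((_root_.seqR ^ n) w) := by
  induction n with
  | zero => simpa using hw
  | succ n ih => rw [pow_succ', Module.End.mul_apply]; exact ih.seqR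

open Polynomial in
/-- The action of the co-analytic Toeplitz operator with polynomial symbol `p`. -/
lemma Tbar_polynomial (p : ℂ[X]) (f : ℂ → ℂ) :
    Tbar (fun z => p.eval z) f = pseries (aeval seqL (p.map (starRingEnd ℂ)) (coef f)) := by
  have hp : DiskSummable p.coeff := fun z _ =>
    summable_of_ne_finset_zero (s := p.support) fun n hn => by
      simp [notMem_support_iff.1 hn]
  have hps : ∀ z, p.eval z = pseries p.coeff z := fun z => by
    rw [pseries, tsum_eq_sum (s := p.support), eval_eq_sum, sum_def]
    intro n hn
    simp [notMem_support_iff.1 hn]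
  funext z
  refine tsum_congr fun n => ?_
  congr 1
  rw [hp.coef_eq fun z _ => hps z, aeval_eq_sum_range, LinearMap.sum_apply, Finset.sum_apply,
    natDegree_map]
  rw [tsum_eq_sum (s := Finset.range (p.natDegree + 1))]
  · refine Finset.sum_congr rfl fun k _ => ?_
    simp [seqL_pow_apply]
  · intro k hk
    rw [coeff_eq_zero_of_natDegree_lt (by simpa using hk)]
    simp

open Polynomial in
lemma memMbar_prod_iff {N : ℕ} (ζ : Fin N → ℂ) (g : ℂ → ℂ) :
    MemMbar (fun z => ∏ j, (z - ζ j)) g ↔ ∃ w, SqSummable w ∧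
      ∀ z ∈ unitDisk, g z = pseries (aeval seqL (∏ j, (X - C (conj (ζ j)))) w) z := by
  have hT : ∀ f, Tbar (fun z => ∏ j, (z - ζ j)) f =
      pseries (aeval seqL (∏ j, (X - C (conj (ζ j)))) (coef f)) := fun f => by
    have h := Tbar_polynomial (∏ j, (X - C (ζ j))) f
    simpa [eval_prod, Polynomial.map_prod] using h
  constructor
  · rintro ⟨f, hf, hg⟩
    refine ⟨coef f, hf.2, fun z hz => ?_⟩
    rw [hg hz, hT]
  · rintro ⟨w, hw, hg⟩
    refine ⟨pseries w, hw.memH2, fun z hz => ?_⟩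
    rw [hT, hw.diskSummable.coef_eq fun _ _ => rfl]
    exact hg z hz

lemma seqL_sub_mul_seqR {ζ : ℂ} (hζ : ‖ζ‖ = 1) :
    (seqL - algebraMap ℂ _ (conj ζ)) * ((-ζ) • seqR) = seqR - algebraMap ℂ _ ζ := by
  have hζ' : conj ζ * ζ = 1 := by rw [RCLike.conj_mul, hζ]; simp
  rw [sub_mul, mul_smul_comm, seqL_mul_seqR, mul_smul_comm, ← Algebra.smul_def, smul_smul,
    Algebra.algebraMap_eq_smul_one]
  have e : -ζ * conj ζ = -1 := by linear_combination -hζ'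
  rw [e]
  module

open Polynomial in
/-- If `a` has all its zeros on the circle, then `a = c z ^ N conj a` there; this is the
corresponding identity between Toeplitz operators. -/
lemma exists_aeval_seqL_mul_seqR_pow {N : ℕ} (ζ : Fin N → ℂ) (hζ : ∀ j, ‖ζ j‖ = 1) :
    ∃ c : ℂ, aeval seqL (∏ j, (X - C (conj (ζ j)))) * (c • seqR ^ N) =
      aeval seqR (∏ j, (X - C (ζ j))) := by
  induction N with
  | zero => exact ⟨1, by simp⟩
  | succ N ih =>
    obtain ⟨c, hc⟩ := ih (fun j => ζ j.succ) fun j => hζ _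
    refine ⟨c * -ζ 0, ?_⟩
    rw [Fin.prod_univ_succ, Fin.prod_univ_succ, mul_comm (X - C (ζ 0)),
      mul_comm (X - C (conj (ζ 0))), map_mul, map_mul, ← hc]
    simp only [map_sub, aeval_X, aeval_C]
    have hcomm : seqR ^ N * (seqR - algebraMap ℂ (Module.End ℂ (ℕ → ℂ)) (ζ 0)) =
        (seqR - algebraMap ℂ (Module.End ℂ (ℕ → ℂ)) (ζ 0)) * seqR ^ N := by
      rw [mul_sub, sub_mul, ← pow_succ, ← pow_succ', Algebra.commutes]
    rw [mul_assoc, mul_assoc, smul_mul_assoc, hcomm, ← seqL_sub_mul_seqR (hζ 0), mul_smul,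
      pow_succ']
    simp only [mul_smul_comm, smul_mul_assoc, mul_assoc]

open Polynomial in
lemma sqSummable_aeval_seqR_and_pseries {N : ℕ} (ζ : Fin N → ℂ) {x : ℕ → ℂ} (hx : SqSummable x) :
    SqSummable (aeval seqR (∏ j, (X - C (ζ j))) x) ∧ ∀ z ∈ unitDisk,
      pseries (aeval seqR (∏ j, (X - C (ζ j))) x) z = (∏ j, (z - ζ j)) * pseries x z := by
  induction N with
  | zero => simpa using hx
  | succ N ih =>
    obtain ⟨h1, h2⟩ := ih fun j => ζ j.succ
    rw [Fin.prod_univ_succ, map_mul, Module.End.mul_apply]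
    simp only [map_sub, aeval_X, aeval_C, LinearMap.sub_apply, Module.algebraMap_end_apply]
    refine ⟨h1.seqR.sub (h1.smul _), fun z hz => ?_⟩
    rw [pseries_sub h1.seqR.diskSummable (h1.smul _).diskSummable hz, pseries_smul,
      pseries_seqR h1.diskSummable hz, h2 z hz, Fin.prod_univ_succ]
    ring

/-- Division by `z` in the bounded factor of a factorization. -/
lemma exists_memHinf_of_id_mul_eq {φ b ψ : ℂ → ℂ} (hφ : DifferentiableOn ℂ φ unitDisk)
    (hb : DifferentiableOn ℂ b unitDisk) (hb0 : b 0 ≠ 0) (hψ : MemHinf ψ)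
    (h : ∀ z ∈ unitDisk, z * φ z = b z * ψ z) :
    ∃ χ, MemHinf χ ∧ ∀ z ∈ unitDisk, φ z = b z * χ z := by
  obtain ⟨hd, C, hC⟩ := hψ
  have hψ0 : ψ 0 = 0 := by
    have := h 0 zero_mem_unitDisk
    rw [zero_mul] at this
    exact (mul_eq_zero.1 this.symm).resolve_left hb0
  have hχ : DifferentiableOn ℂ (dslope ψ 0) unitDisk :=
    (Complex.differentiableOn_dslope unitDisk_mem_nhds_zero).2 hd
  refine ⟨dslope ψ 0, ⟨hχ, C / 1, fun z hz =>
    Complex.norm_dslope_le_div_of_mapsTo_ball hd (fun w hw => ?_) hz⟩, ?_⟩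
  · simpa [hψ0] using hC w hw
  · have hne : ∀ z ∈ unitDisk, z ≠ 0 → φ z = b z * dslope ψ 0 z := fun z hz hz0 => by
      rw [dslope_of_ne _ hz0, slope_def_field, hψ0, sub_zero, sub_zero]
      field_simp
      linear_combination h z hz
    intro z hz
    by_cases hz0 : z = 0
    · have hnhds := isOpen_unitDisk.mem_nhds hz
      have h1 := (hφ.continuousOn.continuousAt hnhds).tendsto.mono_left
        (nhdsWithin_le_nhds (s := {z}ᶜ))
      have h2 := ((hb.mul hχ).continuousOn.continuousAt hnhds).tendsto.mono_left
        (nhdsWithin_le_nhds (s := {z}ᶜ))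
      refine tendsto_nhds_unique h1 (h2.congr' ?_)
      filter_upwards [self_mem_nhdsWithin, mem_nhdsWithin_of_mem_nhds hnhds] with w hw hwD
      exact (hne w hwD (hz0 ▸ hw)).symm
    · exact hne z hz hz0

lemma differentiableOn_prod_sub {N : ℕ} (ζ : Fin N → ℂ) (s : Set ℂ) :
    DifferentiableOn ℂ (fun z => ∏ j, (z - ζ j)) s := by
  fun_prop

open Polynomial in
lemma exists_memHinf_of_multiplier {N : ℕ} (ζ : Fin N → ℂ) (hζ : ∀ j, ‖ζ j‖ = 1) {φ : ℂ → ℂ}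
    (hφ : DifferentiableOn ℂ φ unitDisk)
    (h : ∀ u, SqSummable u → ∃ w, SqSummable w ∧ ∀ z ∈ unitDisk,
      φ z * pseries u z = pseries (aeval seqL (∏ j, (X - C (conj (ζ j)))) w) z) :
    ∃ ψ, MemHinf ψ ∧ ∀ z ∈ unitDisk, φ z = (∏ j, (z - ζ j)) * ψ z := by
  induction N generalizing φ with
  | zero => exact ⟨φ, memHinf_of_multiplier hφ (by simpa using h), by simp⟩
  | succ N ih =>
    set q : ℂ[X] := ∏ j : Fin N, (X - C (conj (ζ j.succ))) with hq
    have hfac : ∀ w, aeval seqL (∏ j, (X - C (conj (ζ j)))) w =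
        seqL (aeval seqL q w) - conj (ζ 0) • aeval seqL q w := fun w => by
      rw [Fin.prod_univ_succ, map_mul, Module.End.mul_apply]
      simp [hq]
    simp only [hfac] at h
    obtain ⟨w₁, hw₁, hw₁φ, hw₁m⟩ := exists_quotient_of_multiplier (hζ 0) fun u hu => by
      obtain ⟨w, hw, he⟩ := h u hu
      exact ⟨_, sqSummable_aeval_seqL hw q, he⟩
    obtain ⟨ψ, hψ, hψ'⟩ := ih (fun j => ζ j.succ) (fun j => hζ _)
      hw₁.diskSummable.differentiableOn fun u hu => by
        obtain ⟨w, hw, he⟩ := h u hu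
        exact ⟨w, hw, fun z hz => (hw₁m u _ hu (sqSummable_aeval_seqL hw q) he z hz).symm⟩
    have hζ' : conj (ζ 0) * ζ 0 = 1 := by rw [RCLike.conj_mul, hζ]; simp
    refine exists_memHinf_of_id_mul_eq (ψ := fun z => -conj (ζ 0) * ψ z) hφ
      (differentiableOn_prod_sub ζ _) ?_ ⟨hψ.1.const_mul _, ?_⟩ fun z hz => ?_
    · refine Finset.prod_ne_zero_iff.2 fun j _ => ?_
      rw [zero_sub, neg_ne_zero, ← norm_ne_zero_iff, hζ j]
      exact one_ne_zero
    · obtain ⟨C, hC⟩ := hψ.2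
      refine ⟨C, fun z hz => ?_⟩
      rw [norm_mul, norm_neg, RCLike.norm_conj, hζ, one_mul]
      exact hC z hz
    · rw [hw₁φ z hz, hψ' z hz, Fin.prod_univ_succ]
      linear_combination (-(∏ j : Fin N, (z - ζ j.succ)) * ψ z) * hζ'

/-- for a polynomial `a` with all zeros on the unit circle, the
multipliers from `H²` to `M(ā)` are `𝔐(1, ā) = a·H^∞`. -/
theorem stmt11 (N : ℕ) (ζ : Fin N → ℂ) (hζ : ∀ j, ‖ζ j‖ = 1) (φ : ℂ → ℂ) :
    (DifferentiableOn ℂ φ unitDisk ∧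
        ∀ f, MemH2 f → MemMbar (fun z => ∏ j, (z - ζ j)) fun z => φ z * f z) ↔
      ∃ ψ, MemHinf ψ ∧ ∀ z ∈ unitDisk, φ z = (∏ j, (z - ζ j)) * ψ z := by
  constructor
  · rintro ⟨hφ, h⟩
    refine exists_memHinf_of_multiplier ζ hζ hφ fun u hu => ?_
    exact (memMbar_prod_iff ζ _).1 (h _ hu.memH2)
  · rintro ⟨ψ, hψ, hφ⟩
    refine ⟨((differentiableOn_prod_sub ζ _).mul hψ.1).congr hφ, fun f hf => ?_⟩
    have hx := hψ.sqSummable_coef_mul (u := coef f) hf.2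
    have hd : DifferentiableOn ℂ (fun z => ψ z * pseries (coef f) z) unitDisk :=
      hψ.1.mul (diskSummable_coef hf.1).differentiableOn
    obtain ⟨c, hc⟩ := exists_aeval_seqL_mul_seqR_pow ζ hζ
    obtain ⟨-, hR⟩ := sqSummable_aeval_seqR_and_pseries ζ hx
    refine (memMbar_prod_iff ζ _).2 ⟨_, (hx.seqR_pow N).smul c, fun z hz => ?_⟩
    rw [← LinearMap.smul_apply, ← Module.End.mul_apply, hc, hR z hz, hφ z hz,
      ← eqOn_pseries_coef hd hz, eqOn_pseries_coef hf.1 hz, mul_assoc]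
end
end

section
/- With a₁(z) = (1+z)(1−z) and a₂(z) = 1+z, the unbounded function φ(z) = (1+z)^{1/2+ε}(1−z)^{−1/2+ε}, 0 < ε < 1/2, is a multiplier from M(\bar{a₁}) to M(\bar{a₂}): φ ∈ M(\bar{a₂}) and (a₁/a₂)φ ∈ H^∞ while φ ∉ H^∞. -/
open Complex Set

noncomputable section

/-- `f` is the sum on the unit disk of the power series with coefficients `c`. -/
def HasPowerSeries (c : ℕ → ℂ) (f : ℂ → ℂ) : Prop :=
  ∀ z ∈ unitDisk, HasSum (fun n => c n * z ^ n) (f z)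

namespace HasPowerSeries

variable {c d : ℕ → ℂ} {f g : ℂ → ℂ}

theorem hasFPowerSeriesOnBall (h : HasPowerSeries c f) :
    HasFPowerSeriesOnBall f (FormalMultilinearSeries.ofScalars ℂ c) 0 1 where
  r_le := by
    refine ENNReal.le_of_forall_nnreal_lt fun r hr => ?_
    have hr' : (r : ℝ) < 1 := by exact_mod_cast hr
    have hz : ((r : ℝ) : ℂ) ∈ unitDisk := by simpa [unitDisk] using hr'
    refine FormalMultilinearSeries.le_radius_of_summable _ ?_
    simpa [FormalMultilinearSeries.ofScalars_norm] using (h _ hz).summable.norm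
  r_pos := one_pos
  hasSum := by
    intro y hy
    have hy' : y ∈ unitDisk := by
      simpa [unitDisk, ← ENNReal.ofReal_one, Metric.eball_ofReal] using hy
    simpa [FormalMultilinearSeries.ofScalars_apply_eq, mul_comm] using h y hy'

theorem differentiableOn (h : HasPowerSeries c f) : DifferentiableOn ℂ f unitDisk := by
  have := h.hasFPowerSeriesOnBall.differentiableOn
  rwa [← ENNReal.ofReal_one, Metric.eball_ofReal] at this

theorem coef_eq (h : HasPowerSeries c f) : coef f = c := by
  have h1 := h.hasFPowerSeriesOnBall.hasFPowerSeriesAt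
  have h2 := h1.analyticAt.hasFPowerSeriesAt
  exact FormalMultilinearSeries.ofScalars_series_injective ℂ ℂ
    (h2.eq_formalMultilinearSeries h1)

theorem memH2 (h : HasPowerSeries c f) (hc : Summable fun n => ‖c n‖ ^ 2) : MemH2 f :=
  ⟨h.differentiableOn, by simpa only [h.coef_eq] using hc⟩

theorem congr (h : HasPowerSeries c f) (hfg : EqOn f g unitDisk) : HasPowerSeries c g :=
  fun z hz => hfg hz ▸ h z hz

theorem add (hf : HasPowerSeries c f) (hg : HasPowerSeries d g) :
    HasPowerSeries (fun n => c n + d n) (fun z => f z + g z) := fun z hz => by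
  simpa [add_mul] using (hf z hz).add (hg z hz)

theorem sub (hf : HasPowerSeries c f) (hg : HasPowerSeries d g) :
    HasPowerSeries (fun n => c n - d n) (fun z => f z - g z) := fun z hz => by
  simpa [sub_mul] using (hf z hz).sub (hg z hz)

theorem const_mul (a : ℂ) (hf : HasPowerSeries c f) :
    HasPowerSeries (fun n => a * c n) (fun z => a * f z) := fun z hz => by
  simpa [mul_assoc] using (hf z hz).mul_left a

theorem shift_right (hf : HasPowerSeries c f) :
    HasPowerSeries (fun n => if n = 0 then 0 else c (n - 1)) (fun z => z * f z) := fun z hz => by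
  rw [← hasSum_nat_add_iff' 1]
  simpa [pow_succ, mul_assoc, mul_comm, mul_left_comm] using (hf z hz).mul_left z

theorem exists_shift_left (hf : HasPowerSeries c f) :
    ∃ g, HasPowerSeries (fun n => c (n + 1)) g ∧ ∀ z ∈ unitDisk, f z = c 0 + z * g z := by
  refine ⟨fun z => ∑' n, c (n + 1) * z ^ n, fun z hz => Summable.hasSum ?_, fun z hz => ?_⟩
  · rcases eq_or_ne z 0 with rfl | h0
    · exact summable_of_ne_finset_zero (s := {0}) fun n hn => by simp_all
    · have := ((summable_nat_add_iff 1).2 (hf z hz).summable).mul_left z⁻¹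
      refine this.congr fun n => ?_
      field_simp
      ring
  · rw [← (hf z hz).tsum_eq, (hf z hz).summable.tsum_eq_zero_add, ← tsum_mul_left]
    simp [pow_succ, mul_assoc, mul_comm]

theorem mul (hf : HasPowerSeries c f) (hg : HasPowerSeries d g) :
    HasPowerSeries (fun n => ∑ p ∈ Finset.HasAntidiagonal.antidiagonal n, c p.1 * d p.2)
      (fun z => f z * g z) := fun z hz => by
  have h1 := (hf z hz).summable.norm
  have h2 := (hg z hz).summable.norm
  have hs := (summable_norm_sum_mul_antidiagonal_of_summable_norm h1 h2).of_norm.hasSum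
  rw [← tsum_mul_tsum_eq_tsum_sum_antidiagonal_of_summable_norm h1 h2, (hf z hz).tsum_eq,
    (hg z hz).tsum_eq] at hs
  refine (congrArg (HasSum · (f z * g z)) (funext fun n => ?_)).mpr hs
  rw [Finset.sum_mul]
  refine Finset.sum_congr rfl fun p hp => ?_
  rw [← Finset.HasAntidiagonal.mem_antidiagonal.1 hp, pow_add]
  ring

theorem comp_sq (hf : HasPowerSeries c f) :
    HasPowerSeries (fun n => if Even n then c (n / 2) else 0) (fun z => f (z ^ 2)) := by
  intro z hz
  have hz2 : z ^ 2 ∈ unitDisk := by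
    simp only [unitDisk, mem_ball_zero_iff, norm_pow] at hz ⊢
    exact pow_lt_one₀ (norm_nonneg z) hz two_ne_zero
  have hi : Function.Injective fun n : ℕ => 2 * n := fun a b h => by simpa using h
  rw [← hi.hasSum_iff]
  · simpa [Function.comp_def, pow_mul] using hf _ hz2
  · intro n hn
    have : ¬ Even n := fun ⟨m, hm⟩ => hn ⟨m, by simp only; omega⟩
    simp [this]

end HasPowerSeries

theorem MemH2.hasPowerSeries {f : ℂ → ℂ} (hf : MemH2 f) : HasPowerSeries (coef f) f := by
  intro z hz
  have := Complex.hasSum_taylorSeries_on_ball hf.1 hz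
  simpa [coef, div_eq_mul_inv, mul_comm, mul_left_comm, mul_assoc] using this

theorem summable_comp_half {u : ℕ → ℝ} (hu : Summable u) :
    Summable fun n => if Even n then u (n / 2) else 0 := by
  have hi : Function.Injective fun n : ℕ => 2 * n := fun a b h => by simpa using h
  rw [← hi.summable_iff]
  · simpa [Function.comp_def] using hu
  · intro n hn
    have : ¬ Even n := fun ⟨m, hm⟩ => hn ⟨m, by simp only; omega⟩
    simp [this]

theorem MemH2.add {f g : ℂ → ℂ} (hf : MemH2 f) (hg : MemH2 g) : MemH2 fun z => f z + g z := by
  refine (hf.hasPowerSeries.add hg.hasPowerSeries).memH2 ?_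
  refine .of_nonneg_of_le (fun _ => by positivity) (fun n => ?_)
    ((hf.2.add hg.2).mul_left 2)
  have h := norm_add_le (coef f n) (coef g n)
  calc ‖coef f n + coef g n‖ ^ 2 ≤ (‖coef f n‖ + ‖coef g n‖) ^ 2 := by gcongr
    _ ≤ _ := add_sq_le

theorem MemH2.const_mul {f : ℂ → ℂ} (a : ℂ) (hf : MemH2 f) : MemH2 fun z => a * f z := by
  refine (hf.hasPowerSeries.const_mul a).memH2 ?_
  simpa [mul_pow] using hf.2.mul_left (‖a‖ ^ 2)

theorem MemH2.id_mul {f : ℂ → ℂ} (hf : MemH2 f) : MemH2 fun z => z * f z := by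
  refine hf.hasPowerSeries.shift_right.memH2 ?_
  rw [← summable_nat_add_iff 1]
  simpa using hf.2

/-- Young inequality `ℓ¹ * ℓ² ⊆ ℓ²`: functions with absolutely summable Taylor coefficients
multiply `H²` into itself. -/
theorem MemH2.mul_of_summable {c : ℕ → ℂ} {u f : ℂ → ℂ} (hu : HasPowerSeries c u)
    (hc : Summable fun n => ‖c n‖) (hf : MemH2 f) : MemH2 fun z => u z * f z := by
  refine (hu.mul hf.hasPowerSeries).memH2 ?_
  have hs := summable_norm_sum_mul_antidiagonal_of_summable_norm
    (f := fun n => ‖c n‖) (g := fun n => ‖coef f n‖ ^ 2) (by simpa using hc) (by simpa using hf.2)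
  refine .of_nonneg_of_le (fun _ => by positivity) (fun n => ?_) (hs.of_norm.mul_left (∑' n, ‖c n‖))
  have h1 : ∑ p ∈ Finset.HasAntidiagonal.antidiagonal n, ‖c p.1‖ ≤ ∑' n, ‖c n‖ := by
    rw [Finset.Nat.sum_antidiagonal_eq_sum_range_succ_mk]
    exact hc.sum_le_tsum _ fun _ _ => norm_nonneg _
  calc ‖∑ p ∈ Finset.HasAntidiagonal.antidiagonal n, c p.1 * coef f p.2‖ ^ 2
      ≤ (∑ p ∈ Finset.HasAntidiagonal.antidiagonal n, ‖c p.1‖ * ‖coef f p.2‖) ^ 2 := by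
        gcongr
        exact (norm_sum_le _ _).trans_eq (by simp)
    _ ≤ (∑ p ∈ Finset.HasAntidiagonal.antidiagonal n, ‖c p.1‖) *
          ∑ p ∈ Finset.HasAntidiagonal.antidiagonal n, ‖c p.1‖ * ‖coef f p.2‖ ^ 2 :=
        Finset.sum_sq_le_sum_mul_sum_of_sq_le_mul _ (fun _ _ => by positivity)
          (fun _ _ => by positivity) fun _ _ => le_of_eq (by ring)
    _ ≤ _ := by gcongr

theorem coef_one_add : coef (fun z => 1 + z) = fun n => if n = 0 ∨ n = 1 then 1 else 0 := by
  refine HasPowerSeries.coef_eq fun z _ => ?_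
  have := hasSum_sum_of_ne_finset_zero (L := .unconditional ℕ) (s := {0, 1})
    (f := fun n => (if n = 0 ∨ n = 1 then 1 else 0) * z ^ n) (fun n hn => by simp_all)
  simpa using this

theorem coef_one_add_mul_one_sub : coef (fun z => (1 + z) * (1 - z)) =
    fun n => if n = 0 then 1 else if n = 2 then -1 else 0 := by
  refine HasPowerSeries.coef_eq fun z _ => ?_
  have := hasSum_sum_of_ne_finset_zero (L := .unconditional ℕ) (s := {0, 2})
    (f := fun n => (if n = 0 then 1 else if n = 2 then -1 else 0) * z ^ n)
    (fun n hn => by simp_all)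
  convert this using 1
  simp
  ring

/-- `(1 + z) H² ⊆ M(ā₂)` for `a₂ = 1 + z`. -/
theorem memMbar_one_add_of_eqOn {f g : ℂ → ℂ} (hg : MemH2 g)
    (hf : EqOn f (fun z => (1 + z) * g z) unitDisk) : MemMbar (fun z => 1 + z) f := by
  refine ⟨fun z => z * g z, hg.id_mul, fun z hz => ?_⟩
  have hs := hg.hasPowerSeries.shift_right
  have h := (hs.add hg.hasPowerSeries) z hz
  rw [hf hz, Tbar, hs.coef_eq, coef_one_add]
  have hT : ∀ n, ∑' k : ℕ, (starRingEnd ℂ) (if k = 0 ∨ k = 1 then 1 else 0) *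
      (if n + k = 0 then 0 else coef g (n + k - 1)) =
      (if n = 0 then 0 else coef g (n - 1)) + coef g n := by
    intro n
    rw [tsum_eq_sum (s := {0, 1}) fun k hk => by simp_all]
    simp
  simp only [hT, h.tsum_eq]
  ring

/-- `M(ā₁) ⊆ (1 - z²) H² + P₁` for `a₁ = 1 - z²`. -/
theorem MemMbar.exists_decomposition {f : ℂ → ℂ}
    (hf : MemMbar (fun z => (1 + z) * (1 - z)) f) :
    ∃ (α β : ℂ) (k : ℂ → ℂ), MemH2 k ∧
      ∀ z ∈ unitDisk, f z = α + β * z + (1 - z ^ 2) * k z := by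
  obtain ⟨h, hh, hfh⟩ := hf
  obtain ⟨k₁, hk₁, e₁⟩ := hh.hasPowerSeries.exists_shift_left
  obtain ⟨k₂, hk₂, e₂⟩ := hk₁.exists_shift_left
  refine ⟨coef h 0, coef h 1, fun z => -1 * k₂ z,
    (hk₂.memH2 ((summable_nat_add_iff 2).2 hh.2)).const_mul _, fun z hz => ?_⟩
  rw [hfh hz, Tbar, coef_one_add_mul_one_sub]
  have hT : ∀ n, ∑' k : ℕ, (starRingEnd ℂ) (if k = 0 then 1 else if k = 2 then -1 else 0) *
      coef h (n + k) = coef h n - coef h (n + 1 + 1) := by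
    intro n
    rw [tsum_eq_sum (s := {0, 2}) fun k hk => by simp_all]
    simp [sub_eq_add_neg]
  simp only [hT, (hh.hasPowerSeries.sub hk₂ z hz).tsum_eq]
  rw [e₁ z hz, e₂ z hz]
  ring

section Binomial

variable {s : ℝ}

theorem hasPowerSeries_one_div_one_sub_cpow (s : ℝ) :
    HasPowerSeries (fun n => ((Ring.multichoose s n : ℝ) : ℂ)) fun z => 1 / (1 - z) ^ (s : ℂ) := by
  intro z hz
  have hz' : z ∈ Metric.eball (0 : ℂ) 1 := by
    rwa [← ENNReal.ofReal_one, Metric.eball_ofReal]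
  have h := (Complex.one_div_one_sub_cpow_hasFPowerSeriesOnBall_zero s).hasSum hz'
  have hc : ∀ n : ℕ, ((Ring.multichoose s n : ℝ) : ℂ) = Ring.choose ((s : ℂ) + n - 1) n := by
    intro n
    rw [← Ring.multichoose_eq]
    exact Ring.map_multichoose (algebraMap ℝ ℂ) _ _
  simpa [FormalMultilinearSeries.ofScalars_apply_eq, hc, mul_comm] using h

theorem multichoose_succ_eq (s : ℝ) (n : ℕ) :
    Ring.multichoose s (n + 1) = Ring.multichoose s n * ((s + n) / (n + 1)) := by
  have h0 := Ring.factorial_nsmul_multichoose_eq_ascPochhammer s n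
  have h1 := Ring.factorial_nsmul_multichoose_eq_ascPochhammer s (n + 1)
  rw [Polynomial.ascPochhammer_smeval_eq_eval, nsmul_eq_mul] at h0 h1
  rw [ascPochhammer_succ_eval, ← h0, Nat.factorial_succ] at h1
  have hn : (n.factorial : ℝ) ≠ 0 := by positivity
  have hn1 : (n : ℝ) + 1 ≠ 0 := by positivity
  push_cast at h1
  field_simp
  apply mul_left_cancel₀ hn
  linear_combination h1

theorem multichoose_nonneg (hs : 0 ≤ s) (n : ℕ) : 0 ≤ Ring.multichoose s n := by
  induction n with
  | zero => simp
  | succ n ih => rw [multichoose_succ_eq]; positivity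

theorem antitone_multichoose (hs : 0 ≤ s) (hs1 : s ≤ 1) : Antitone (Ring.multichoose s) := by
  refine antitone_nat_of_succ_le fun n => ?_
  rw [multichoose_succ_eq]
  refine mul_le_of_le_one_right (multichoose_nonneg hs n) ?_
  rw [div_le_one (by positivity)]
  linarith

theorem multichoose_le_rpow (hs : 0 ≤ s) (hs1 : s ≤ 1) (n : ℕ) :
    Ring.multichoose s n ≤ ((n : ℝ) + 1) ^ (s - 1) := by
  induction n with
  | zero => simp
  | succ n ih =>
    rw [multichoose_succ_eq]
    have hn : (0 : ℝ) < n + 1 := by positivity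
    set x : ℝ := 1 / (n + 1) with hx
    have hx0 : 0 < x := by positivity
    have hb := rpow_one_add_le_one_add_mul_self (s := x) (by linarith)
      (p := 1 - s) (by linarith) (by linarith)
    have e1 : (s + n) / (n + 1) = 1 - (1 - s) * x := by rw [hx]; field_simp; ring
    have e2 : (((n + 1 : ℕ) : ℝ) + 1) = (n + 1) * (1 + x) := by
      rw [hx]; push_cast; field_simp
    have e3 : (1 + x) ^ (s - 1) = ((1 + x) ^ (1 - s))⁻¹ := by
      rw [← Real.rpow_neg (by positivity), neg_sub]
    rw [e2, Real.mul_rpow hn.le (by positivity), e3]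
    have hp : 0 < (1 + x) ^ (1 - s) := by positivity
    have hr : (s + n) / (n + 1) ≤ ((1 + x) ^ (1 - s))⁻¹ := by
      rw [← one_div, le_div_iff₀ hp, e1]
      have h0 : 0 ≤ 1 - (1 - s) * x := by rw [← e1]; positivity
      calc _ ≤ (1 - (1 - s) * x) * (1 + (1 - s) * x) := by gcongr
        _ ≤ 1 := by nlinarith [sq_nonneg ((1 - s) * x)]
    exact mul_le_mul ih hr (by positivity) (by positivity)

theorem summable_multichoose_sq (hs : 0 ≤ s) (hs2 : s < 1 / 2) :
    Summable fun n => Ring.multichoose s n ^ 2 := by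
  have h := (summable_nat_add_iff 1).2 (Real.summable_nat_rpow (p := 2 * (s - 1)) |>.2 (by linarith))
  refine .of_nonneg_of_le (fun _ => by positivity) (fun n => ?_) h
  have h1 := multichoose_le_rpow hs (by linarith) n
  have h0 := multichoose_nonneg hs n
  calc _ ≤ (((n : ℝ) + 1) ^ (s - 1)) ^ 2 := by gcongr
    _ = _ := by
      rw [mul_comm, Real.rpow_mul (by positivity)]
      push_cast
      norm_cast

/-- `(1 - z²)^{-s} ∈ H²` for `0 ≤ s < 1/2`. -/
theorem memH2_one_div_one_sub_sq_cpow (hs : 0 ≤ s) (hs2 : s < 1 / 2) :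
    MemH2 fun z => 1 / (1 - z ^ 2) ^ (s : ℂ) := by
  refine (hasPowerSeries_one_div_one_sub_cpow s).comp_sq.memH2 ?_
  refine (summable_comp_half (summable_multichoose_sq hs hs2)).congr fun n => ?_
  split_ifs <;> simp

theorem summable_sub_multichoose (hs : 0 ≤ s) (hs1 : s ≤ 1) :
    Summable fun n => Ring.multichoose s n - Ring.multichoose s (n + 1) := by
  refine summable_of_sum_range_le (c := Ring.multichoose s 0)
    (fun n => sub_nonneg.2 (antitone_multichoose hs hs1 n.le_succ)) fun n => ?_
  rw [Finset.sum_range_sub']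
  linarith [multichoose_nonneg hs n]

/-- `(1 - z²)^{1-s}` multiplies `H²` into itself for `0 ≤ s ≤ 1`. -/
theorem MemH2.one_sub_sq_cpow_mul (hs : 0 ≤ s) (hs1 : s ≤ 1) {f : ℂ → ℂ} (hf : MemH2 f) :
    MemH2 fun z => (1 - z ^ 2) * (1 / (1 - z ^ 2) ^ (s : ℂ)) * f z := by
  have h := hasPowerSeries_one_div_one_sub_cpow s
  have h' := ((h.sub h.shift_right).congr
    (g := fun z => (1 - z) * (1 / (1 - z) ^ (s : ℂ))) fun z _ => by ring).comp_sq
  refine MemH2.mul_of_summable h' ?_ hf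
  have hd : Summable fun n => ‖((Ring.multichoose s n : ℝ) : ℂ) -
      if n = 0 then 0 else ((Ring.multichoose s (n - 1) : ℝ) : ℂ)‖ := by
    rw [← summable_nat_add_iff 1]
    refine (summable_sub_multichoose hs hs1).congr fun n => ?_
    rw [if_neg n.succ_ne_zero, Nat.add_sub_cancel, ← Complex.ofReal_sub, Complex.norm_real,
      Real.norm_eq_abs, abs_sub_comm,
      abs_of_nonneg (sub_nonneg.2 (antitone_multichoose hs hs1 n.le_succ))]
  refine (summable_comp_half hd).congr fun n => ?_
  split_ifs <;> simp

end Binomial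

theorem one_sub_sq_cpow_eq {z : ℂ} (hz : z ∈ unitDisk) (a : ℂ) :
    (1 - z ^ 2) ^ a = (1 + z) ^ a * (1 - z) ^ a := by
  have hz1 : ‖z‖ < 1 := by simpa [unitDisk] using hz
  have hre := abs_lt.1 ((Complex.abs_re_le_norm z).trans_lt hz1)
  have h1 : 0 < (1 + z).re := by simp; linarith [hre.1]
  have h2 : 0 < (1 - z).re := by simp; linarith [hre.2]
  have n1 : 1 + z ≠ 0 := fun h => by simp [h] at h1
  have n2 : 1 - z ≠ 0 := fun h => by simp [h] at h2
  have a1 := abs_lt.1 (Complex.abs_arg_lt_pi_div_two_iff.2 (Or.inl h1))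
  have a2 := abs_lt.1 (Complex.abs_arg_lt_pi_div_two_iff.2 (Or.inl h2))
  rw [show 1 - z ^ 2 = (1 + z) * (1 - z) by ring, Complex.cpow_def_of_ne_zero (mul_ne_zero n1 n2),
    Complex.cpow_def_of_ne_zero n1, Complex.cpow_def_of_ne_zero n2,
    Complex.log_mul n1 n2 ⟨by linarith, by linarith⟩, add_mul, Complex.exp_add]

theorem one_add_cpow_mul_one_sub_cpow_eq {z : ℂ} (hz : z ∈ unitDisk) (s : ℂ) :
    (1 + z) ^ (1 - s) * (1 - z) ^ (-s) = (1 + z) * (1 / (1 - z ^ 2) ^ s) := by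
  have hz1 : ‖z‖ < 1 := by simpa [unitDisk] using hz
  have n1 : 1 + z ≠ 0 := fun h => by
    rw [show z = -1 by linear_combination h] at hz1
    simp at hz1
  rw [one_sub_sq_cpow_eq hz, Complex.cpow_neg, Complex.cpow_sub _ _ n1, Complex.cpow_one]
  simp only [div_eq_mul_inv, mul_inv]
  ring

/-- `(1 + z)^{1-s} (1 - z)^{-s}` is unbounded near `z = 1`. -/
theorem not_memHinf_one_add_cpow_mul_one_sub_cpow {s : ℝ} (hs : 0 < s) (hs1 : s ≤ 1) :
    ¬ MemHinf fun z => (1 + z) ^ (1 - (s : ℂ)) * (1 - z) ^ (-(s : ℂ)) := by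
  rintro ⟨-, C, hC⟩
  have ht := (tendsto_rpow_atTop hs).eventually_gt_atTop C
  obtain ⟨y, hy, hy1⟩ := (ht.and (Filter.eventually_gt_atTop 1)).exists
  have hy0 : 0 < y := by linarith
  have hinv : y⁻¹ < 1 := inv_lt_one_of_one_lt₀ hy1
  have hinv0 : 0 < y⁻¹ := by positivity
  have hx : ((1 - y⁻¹ : ℝ) : ℂ) ∈ unitDisk := by
    rw [unitDisk, mem_ball_zero_iff, Complex.norm_real, Real.norm_eq_abs, abs_lt]
    constructor <;> linarith
  have h := hC _ hx
  have e1 : (1 + ((1 - y⁻¹ : ℝ) : ℂ)) = ((2 - y⁻¹ : ℝ) : ℂ) := by push_cast; ring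
  have e2 : (1 - ((1 - y⁻¹ : ℝ) : ℂ)) = ((y⁻¹ : ℝ) : ℂ) := by push_cast; ring
  rw [norm_mul, e1, e2, Complex.norm_cpow_eq_rpow_re_of_pos (by linarith),
    Complex.norm_cpow_eq_rpow_re_of_pos hinv0] at h
  simp only [Complex.sub_re, Complex.one_re, Complex.ofReal_re, Complex.neg_re] at h
  rw [Real.inv_rpow hy0.le, Real.rpow_neg hy0.le, inv_inv] at h
  have h1 : 1 ≤ (2 - y⁻¹) ^ (1 - s) := Real.one_le_rpow (by linarith) (by linarith)
  have h2 : 0 < y ^ s := by positivity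
  nlinarith

theorem norm_one_sub_sq_mul_one_div_cpow_le {s : ℝ} (hs1 : s < 1) {z : ℂ} (hz : z ∈ unitDisk) :
    ‖(1 - z ^ 2) * (1 / (1 - z ^ 2) ^ (s : ℂ))‖ ≤ 2 ^ (1 - s) := by
  have hz1 : ‖z‖ < 1 := by simpa [unitDisk] using hz
  have hzz : ‖z ^ 2‖ < 1 := by
    rw [norm_pow]; exact pow_lt_one₀ (norm_nonneg z) hz1 two_ne_zero
  have h2 : ‖1 - z ^ 2‖ ≤ 2 := (norm_sub_le _ _).trans (by rw [norm_one]; linarith)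
  have h0 : 0 < ‖1 - z ^ 2‖ := norm_pos_iff.2 fun h => by
    rw [← sub_eq_zero.1 h, norm_one] at hzz
    exact lt_irrefl _ hzz
  rw [mul_one_div, norm_div, Complex.norm_cpow_real]
  calc _ = ‖1 - z ^ 2‖ ^ (1 - s) := by rw [Real.rpow_sub h0, Real.rpow_one]
    _ ≤ _ := Real.rpow_le_rpow h0.le h2 (by linarith)

/-- with `a₁(z) = (1+z)(1-z)` and `a₂(z) = 1+z`, the unbounded
function `φ(z) = (1+z)^{1/2+ε}(1-z)^{-1/2+ε}`, `0 < ε < 1/2`, is a multiplier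
from `M(ā₁)` to `M(ā₂)`: `φ ∈ M(ā₂)` and `(a₁/a₂)φ = (1-z)φ ∈ H^∞`, while
`φ ∉ H^∞`. -/
theorem stmt12 (ε : ℝ) (hε : 0 < ε) (hε2 : ε < 1 / 2) (φ : ℂ → ℂ)
    (hφ : ∀ z : ℂ, φ z =
      (1 + z) ^ ((1 / 2 : ℂ) + (ε : ℂ)) * (1 - z) ^ (-(1 / 2 : ℂ) + (ε : ℂ))) :
    Mult (fun z => (1 + z) * (1 - z)) (fun z => 1 + z) φ ∧
      MemMbar (fun z => 1 + z) φ ∧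
      MemHinf (fun z => (1 - z) * φ z) ∧
      ¬ MemHinf φ := by
  set s : ℝ := 1 / 2 - ε with hs_def
  have hs0 : 0 < s := by linarith
  have hs2 : s < 1 / 2 := by linarith
  have hφs : φ = fun z => (1 + z) ^ (1 - (s : ℂ)) * (1 - z) ^ (-(s : ℂ)) := by
    funext z
    rw [hφ, hs_def]
    push_cast
    congr 2 <;> ring
  set g : ℂ → ℂ := fun z => 1 / (1 - z ^ 2) ^ (s : ℂ) with hg_def
  have hg : MemH2 g := memH2_one_div_one_sub_sq_cpow hs0.le hs2
  have hφg : EqOn φ (fun z => (1 + z) * g z) unitDisk := fun z hz => by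
    rw [hφs]
    exact one_add_cpow_mul_one_sub_cpow_eq hz _
  have hφd : DifferentiableOn ℂ φ unitDisk :=
    ((differentiableOn_const 1).add differentiableOn_id |>.mul hg.1).congr hφg
  refine ⟨⟨hφd, fun f hf => ?_⟩, memMbar_one_add_of_eqOn hg hφg,
    ⟨((differentiableOn_const 1).sub differentiableOn_id).mul hφd, 2 ^ (1 - s), fun z hz => ?_⟩, ?_⟩
  · obtain ⟨α, β, k, hk, hfk⟩ := hf.exists_decomposition
    have hG := ((hg.const_mul α).add (hg.id_mul.const_mul β)).add
      (hk.one_sub_sq_cpow_mul hs0.le (by linarith : s ≤ 1))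
    refine memMbar_one_add_of_eqOn hG fun z hz => ?_
    simp only [hfk z hz, hφg hz, hg_def]
    ring
  · refine le_of_eq_of_le ?_ (norm_one_sub_sq_mul_one_div_cpow_le (by linarith : s < 1) hz)
    congr 1
    simp only [hφg hz, hg_def]
    ring
  · rw [hφs]
    exact not_memHinf_one_add_cpow_mul_one_sub_cpow hs0 (by linarith)
end
end
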